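/- Let H be a connected graded commutative Hopf algebra over ℂ, with g_A its Lie algebra of infinitesimal characters with values in Laurent series A = ℂ((λ)). Let f: g_A → g_A be Ad-covariant, let L_0 ∈ g_A satisfy [f(L_0), L_0] = 0, and set X = f(L_0). Suppose g_±: ℝ → G_A are pointwise differentiable curves with g_±(0) = ε which furnish the Birkhoff factorization exp(−tX) = g_-(t)^{-1} ⋆ g_+(t), i.e. g_+(t)(x) ∈ A_+ and g_-(t)(x) − ε(x) ∈ A_- for all x ∈ H and all t. Then Ad(g_-(t))L_0 = Ad(g_+(t))L_0 for all t, and L(t) := Ad(g_±(t))L_0 satisfies the Lax pair equation dL/dt = [L, M] with M = (1/2)·R(f(L)), where R = P_+ − P_- is applied to the A-valued entries. -/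

import Mathlib

open scoped TensorProduct

set_option synthInstance.maxHeartbeats 1000000
set_option maxHeartbeats 1600000
set_option linter.unnecessarySeqFocus false

noncomputable section

/-- The algebra `A = ℂ((λ))` of formal Laurent series with finite pole part. -/
abbrev LS := LaurentSeries ℂ

/-- `ℂ`-scalars commute with multiplication of Laurent series. -/
instance : SMulCommClass ℂ LS LS := by
  constructor
  intro c a b
  show c • (a * b) = a * (c • b)
  rw [← HahnSeries.single_zero_mul_eq_smul, ← HahnSeries.single_zero_mul_eq_smul]
  ring

/-- Scalar tower for `ℂ`-scalars and Laurent series. -/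
instance : IsScalarTower ℂ LS LS := by
  constructor
  intro c a b
  show (c • a) * b = c • (a * b)
  rw [← HahnSeries.single_zero_mul_eq_smul, ← HahnSeries.single_zero_mul_eq_smul]
  ring

/-- `A₊ = ℂ[[λ]]`: the holomorphic part. -/
def Aplus (f : LS) : Prop := ∀ n : ℤ, n < 0 → f.coeff n = 0

/-- `A₋ = λ⁻¹ℂ[λ⁻¹]`: the polar part. -/
def Aminus (f : LS) : Prop := ∀ n : ℤ, 0 ≤ n → f.coeff n = 0

/-- The formal variable `λ`. -/
def lam : LS := HahnSeries.single (1 : ℤ) (1 : ℂ)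

/-- `λ^k` for `k : ℤ`. -/
def lamZ (k : ℤ) : LS := HahnSeries.single k (1 : ℂ)

/-- `e^{cλ} = Σ_k c^k λ^k / k!` as a Laurent series. -/
def expL (c : ℂ) : LS :=
  HahnSeries.ofPowerSeries ℤ ℂ (PowerSeries.mk fun k => c ^ k / (k.factorial : ℂ))

section Hopf

variable {H : Type} [Ring H] [HopfAlgebra ℂ H]

/-- Convolution product of linear maps from a Hopf algebra to `A`. -/
def conv (f g : H →ₗ[ℂ] LS) : H →ₗ[ℂ] LS :=
  LinearMap.mul' ℂ LS ∘ₗ TensorProduct.map f g ∘ₗ Coalgebra.comul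

/-- The unit `ε` of the convolution algebra. -/
def epsA : H →ₗ[ℂ] LS := LinearMap.toSpanSingleton ℂ LS 1 ∘ₗ Coalgebra.counit

/-- Characters: algebra morphisms `H → A` sending `1` to `1`. -/
def IsCharacter (φ : H →ₗ[ℂ] LS) : Prop :=
  φ 1 = 1 ∧ ∀ x y : H, φ (x * y) = φ x * φ y

/-- The group inverse of a character: `φ⁻¹ = φ ∘ S`. -/
def charInv (φ : H →ₗ[ℂ] LS) : H →ₗ[ℂ] LS := φ ∘ₗ HopfAlgebra.antipode (R := ℂ)

/-- Infinitesimal characters: `Z(xy) = Z(x)ε(y) + ε(x)Z(y)`. -/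
def IsInfChar (Z : H →ₗ[ℂ] LS) : Prop :=
  ∀ x y : H, Z (x * y) = Z x * epsA y + epsA x * Z y

/-- The Lie bracket `[Z,Z'] = Z⋆Z' − Z'⋆Z` on infinitesimal characters. -/
def lieBr (Z W : H →ₗ[ℂ] LS) : H →ₗ[ℂ] LS := conv Z W - conv W Z

/-- The adjoint action `Ad(g)L = g⋆L⋆g⁻¹`. -/
def Adc (g L : H →ₗ[ℂ] LS) : H →ₗ[ℂ] LS := conv g (conv L (charInv g))

/-- Convolution powers `Z^{⋆k}`. -/
def convPow (Z : H →ₗ[ℂ] LS) : ℕ → (H →ₗ[ℂ] LS)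
  | 0 => epsA
  | k + 1 => conv Z (convPow Z k)

/-- `E = exp(Z)`, the convolution exponential: for each `x ∈ H` the series
`Σ_k Z^{⋆k}(x)/k!` stabilizes (a finite sum by connectedness) with value `E(x)`. -/
def IsConvExp (Z E : H →ₗ[ℂ] LS) : Prop :=
  ∀ x : H, ∃ N : ℕ, ∀ M : ℕ, N ≤ M →
    E x = ∑ k ∈ Finset.range M, ((k.factorial : ℂ))⁻¹ • convPow Z k x

/- ℂ-valued (scalar) versions, for `β`-functions. -/

/-- Convolution product of ℂ-valued linear maps on a Hopf algebra. -/
def convC (f g : H →ₗ[ℂ] ℂ) : H →ₗ[ℂ] ℂ :=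
  LinearMap.mul' ℂ ℂ ∘ₗ TensorProduct.map f g ∘ₗ Coalgebra.comul

/-- ℂ-valued characters. -/
def IsCharacterC (φ : H →ₗ[ℂ] ℂ) : Prop :=
  φ 1 = 1 ∧ ∀ x y : H, φ (x * y) = φ x * φ y

/-- The group inverse of a ℂ-valued character. -/
def charInvC (φ : H →ₗ[ℂ] ℂ) : H →ₗ[ℂ] ℂ := φ ∘ₗ HopfAlgebra.antipode (R := ℂ)

/-- ℂ-valued infinitesimal characters. -/
def IsInfCharC (Z : H →ₗ[ℂ] ℂ) : Prop :=
  ∀ x y : H, Z (x * y) = Z x * Coalgebra.counit y + Coalgebra.counit x * Z y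

end Hopf

section Graded

variable {H : Type} [Ring H] [HopfAlgebra ℂ H]
variable (𝒜 : ℕ → Submodule ℂ H) [GradedAlgebra 𝒜]

/-- Connectedness: `H₀ = ℂ·1`. -/
def IsConnectedGrading : Prop := 𝒜 0 = Submodule.span ℂ {(1 : H)}

/-- The coproduct is grading-preserving: `Δ(H_n) ⊆ Σ_{i+j=n} H_i ⊗ H_j`. -/
def ComulGraded : Prop :=
  ∀ n : ℕ, ∀ x ∈ 𝒜 n, Coalgebra.comul (R := ℂ) x ∈
    ⨆ p : {p : ℕ × ℕ // p.1 + p.2 = n},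
      LinearMap.range (TensorProduct.map ((𝒜 p.1.1).subtype) ((𝒜 p.1.2).subtype))

/-- The counit is grading-preserving: it vanishes in positive degrees. -/
def CounitGraded : Prop := ∀ n : ℕ, 0 < n → ∀ x ∈ 𝒜 n, Coalgebra.counit (R := ℂ) x = 0

/-- The antipode is grading-preserving. -/
def AntipodeGraded : Prop := ∀ n : ℕ, ∀ x ∈ 𝒜 n, HopfAlgebra.antipode (R := ℂ) x ∈ 𝒜 n

/-- The grading biderivation `Y(x) = n·x` for `x ∈ H_n`. -/
def Ymap : H →ₗ[ℂ] H :=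
  (DFinsupp.lsum ℕ fun n : ℕ => ((n : ℂ) • (𝒜 n).subtype)) ∘ₗ
    (DirectSum.decomposeLinearEquiv 𝒜).toLinearMap

/-- `φ^t`, defined by `φ^t(x) = e^{tλn}·φ(x)` for homogeneous `x` of degree `n`. -/
def charScale (t : ℂ) (φ : H →ₗ[ℂ] LS) : H →ₗ[ℂ] LS :=
  (DFinsupp.lsum ℕ fun n : ℕ => (expL (t * (n : ℂ)) • (φ ∘ₗ (𝒜 n).subtype))) ∘ₗ
    (DirectSum.decomposeLinearEquiv 𝒜).toLinearMap

/-- `R̃(φ) = φ^{-1} ⋆ (φ ∘ Y)`. -/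
def Rtilde (φ : H →ₗ[ℂ] LS) : H →ₗ[ℂ] LS := conv (charInv φ) (φ ∘ₗ Ymap 𝒜)

/-- `(φm, φp)` is the Birkhoff decomposition of `φ`: `φ = φm^{-1} ⋆ φp`, i.e. `φm ⋆ φ = φp`,
with `φp` holomorphic and `φm − ε` a pure pole part. -/
def IsBirkhoff (φ φm φp : H →ₗ[ℂ] LS) : Prop :=
  IsCharacter φm ∧ IsCharacter φp ∧ (∀ x, Aplus (φp x)) ∧
    (∀ x, Aminus (φm x - epsA x)) ∧ conv φm φ = φp

/-- A character is local if the negative Birkhoff part of `φ^t` is independent of `t`. -/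
def IsLocal (φ : H →ₗ[ℂ] LS) : Prop :=
  IsCharacter φ ∧ ∃ φm : H →ₗ[ℂ] LS, ∀ t : ℂ, ∃ φp, IsBirkhoff (charScale 𝒜 t φ) φm φp

/-- `B = tildeβ_φ`:  `B(x) = (d/dt)|_{t=0} (φ^{-1} ⋆ φ^t)(x)`, coefficientwise. -/
def HasTildeBeta (φ B : H →ₗ[ℂ] LS) : Prop :=
  ∀ (x : H) (n : ℤ),
    HasDerivAt (fun t : ℂ => ((conv (charInv φ) (charScale 𝒜 t φ)) x).coeff n)
      ((B x).coeff n) 0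

/-- The `β`-function `β_φ = −(Res φ₋) ∘ Y` of a local character whose negative
Birkhoff part is `φm`. -/
def betaFn (φm : H →ₗ[ℂ] LS) : H → ℂ := fun x => -((φm (Ymap 𝒜 x)).coeff (-1))

end Graded

section Curves

variable {H : Type} [Ring H] [HopfAlgebra ℂ H]

/-- Pointwise (coefficientwise) derivative of a curve of maps `H → A`. -/
def HasDerivAtF (F : ℝ → (H →ₗ[ℂ] LS)) (F' : H →ₗ[ℂ] LS) (t : ℝ) : Prop :=
  ∀ (x : H) (n : ℤ), HasDerivAt (fun s : ℝ => ((F s) x).coeff n) ((F' x).coeff n) t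

/-- Pointwise differentiability of a curve of maps `H → A`. -/
def PointwiseDifferentiable (F : ℝ → (H →ₗ[ℂ] LS)) : Prop :=
  ∀ (x : H) (n : ℤ), Differentiable ℝ (fun s : ℝ => ((F s) x).coeff n)

end Curves

/-- The operator `R = P₊ − P₋` on Laurent series. -/
def Rop : LS →ₗ[ℂ] LS where
  toFun f :=
    { coeff := fun n => if n < 0 then -f.coeff n else f.coeff n
      isPWO_support' := f.isPWO_support'.mono (by
        intro n hn
        simp only [Function.mem_support] at hn ⊢
        by_cases h : n < 0 <;> simp_all) }
  map_add' f g := by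
    ext n
    by_cases h : n < 0 <;> simp [h] <;> ring
  map_smul' c f := by
    ext n
    by_cases h : n < 0 <;> simp [h]


theorem ls_coeff_mul (a b : LS) (p q : ℤ) (ha : ∀ n < p, a.coeff n = 0)
    (hb : ∀ n < q, b.coeff n = 0) (n : ℤ) :
    (a * b).coeff n = ∑ i ∈ Finset.Icc p (n - q), a.coeff i * b.coeff (n - i) := by
  rw [HahnSeries.coeff_mul]
  refine Finset.sum_of_injOn Prod.fst ?_ ?_ ?_ ?_
  · rintro ⟨i, j⟩ hi ⟨i', j'⟩ hi' h
    simp only [Finset.mem_coe, Finset.mem_antidiagonal] at hi hi' h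
    ext <;> simp <;> omega
  · rintro ⟨i, j⟩ hi
    simp only [Finset.mem_coe, Finset.mem_antidiagonal, HahnSeries.mem_support] at hi
    simp only [Finset.coe_Icc, Set.mem_Icc]
    constructor
    · by_contra h
      exact hi.1 (ha _ (by omega))
    · by_contra h
      exact hi.2.1 (hb _ (by omega))
  · intro i _ hi
    by_contra h
    apply hi
    refine ⟨(i, n - i), ?_, rfl⟩
    simp only [Finset.mem_coe, Finset.mem_antidiagonal, HahnSeries.mem_support]
    exact ⟨left_ne_zero_of_mul h, right_ne_zero_of_mul h, by omega⟩
  · rintro ⟨i, j⟩ hi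
    simp only [Finset.mem_antidiagonal] at hi
    have : j = n - i := by omega
    simp [this]

theorem ls_bdd (a : LS) : ∃ p : ℤ, ∀ n < p, a.coeff n = 0 :=
  ⟨a.order, fun _ h => HahnSeries.coeff_eq_zero_of_lt_order h⟩

theorem ls_hasDeriv_mul (a b : ℝ → LS) (a' b' : LS) (t : ℝ) (p q : ℤ)
    (ha : ∀ s, ∀ n < p, (a s).coeff n = 0) (hb : ∀ s, ∀ n < q, (b s).coeff n = 0)
    (hda : ∀ n, HasDerivAt (fun s => (a s).coeff n) (a'.coeff n) t)
    (hdb : ∀ n, HasDerivAt (fun s => (b s).coeff n) (b'.coeff n) t) (n : ℤ) :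
    HasDerivAt (fun s => (a s * b s).coeff n) ((a' * b t + a t * b').coeff n) t := by
  have ha' : ∀ n < p, a'.coeff n = 0 := fun n hn => by
    have h := hda n
    simp only [ha _ n hn] at h
    exact h.unique (hasDerivAt_const _ _)
  have hb' : ∀ n < q, b'.coeff n = 0 := fun n hn => by
    have h := hdb n
    simp only [hb _ n hn] at h
    exact h.unique (hasDerivAt_const _ _)
  rw [HahnSeries.coeff_add, ls_coeff_mul _ _ p q ha' (hb t), ls_coeff_mul _ _ p q (ha t) hb',
    ← Finset.sum_add_distrib]
  simp only [fun s => ls_coeff_mul (a s) (b s) p q (ha s) (hb s)]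
  exact HasDerivAt.fun_sum fun i _ => (hda i).mul (hdb (n - i))

section ConvAlg

variable {H : Type} [Ring H] [HopfAlgebra ℂ H]

theorem conv_assoc' (f g h : H →ₗ[ℂ] LS) : conv (conv f g) h = conv f (conv g h) :=
  congrArg WithConv.ofConv
    (mul_assoc (WithConv.toConv f) (WithConv.toConv g) (WithConv.toConv h))

theorem conv_add' (f g h : H →ₗ[ℂ] LS) : conv f (g + h) = conv f g + conv f h := by
  simp [conv, TensorProduct.map_add_right, LinearMap.add_comp, LinearMap.comp_add]

theorem add_conv' (f g h : H →ₗ[ℂ] LS) : conv (f + g) h = conv f h + conv g h := by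
  simp [conv, TensorProduct.map_add_left, LinearMap.add_comp, LinearMap.comp_add]

theorem conv_smul' (c : ℂ) (f g : H →ₗ[ℂ] LS) : conv f (c • g) = c • conv f g := by
  simp [conv, TensorProduct.map_smul_right, LinearMap.smul_comp, LinearMap.comp_smul]

theorem smul_conv' (c : ℂ) (f g : H →ₗ[ℂ] LS) : conv (c • f) g = c • conv f g := by
  simp [conv, TensorProduct.map_smul_left, LinearMap.smul_comp, LinearMap.comp_smul]

theorem conv_repr (f g : H →ₗ[ℂ] LS) {x : H} {ι : Type} (r : Coalgebra.Repr ℂ x ι) :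
    conv f g x = ∑ i ∈ r.index, f (r.left i) * g (r.right i) := by
  simp [conv, ← r.eq]

theorem conv_neg' (f g : H →ₗ[ℂ] LS) : conv f (-g) = - conv f g := by
  ext1 x
  have r := Coalgebra.Repr.arbitrary ℂ x
  rw [LinearMap.neg_apply, conv_repr _ _ r, conv_repr _ _ r, ← Finset.sum_neg_distrib]
  exact Finset.sum_congr rfl fun i _ => mul_neg (f (r.left i)) (g (r.right i))

theorem neg_conv' (f g : H →ₗ[ℂ] LS) : conv (-f) g = - conv f g := by
  ext1 x
  have r := Coalgebra.Repr.arbitrary ℂ x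
  rw [LinearMap.neg_apply, conv_repr _ _ r, conv_repr _ _ r, ← Finset.sum_neg_distrib]
  exact Finset.sum_congr rfl fun i _ => neg_mul (f (r.left i)) (g (r.right i))

theorem neg_add_lm (f : H →ₗ[ℂ] LS) : -f + f = 0 := by
  ext x n
  simp

theorem eq_neg_lm {f g : H →ₗ[ℂ] LS} (h : f + g = 0) : g = -f := by
  ext x n
  have h1 := congrArg (fun u : H →ₗ[ℂ] LS => (u x).coeff n) h
  simp only [LinearMap.add_apply, HahnSeries.coeff_add, LinearMap.zero_apply,
    HahnSeries.coeff_zero] at h1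
  rw [LinearMap.neg_apply, HahnSeries.coeff_neg]
  linear_combination h1

theorem epsA_apply (x : H) : epsA x = Coalgebra.counit (R := ℂ) x • (1 : LS) := by
  simp [epsA]

theorem eps_conv (f : H →ₗ[ℂ] LS) : conv epsA f = f := by
  ext1 x
  have r := Coalgebra.Repr.arbitrary ℂ x
  rw [conv_repr _ _ r]
  simp only [epsA_apply, smul_mul_assoc, one_mul]
  conv_rhs => rw [← Coalgebra.sum_counit_smul r]
  simp

theorem conv_eps (f : H →ₗ[ℂ] LS) : conv f epsA = f := by
  ext1 x
  have r := Coalgebra.Repr.arbitrary ℂ x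
  rw [conv_repr _ _ r]
  simp only [epsA_apply, mul_smul_comm, mul_one]
  have h := congrArg (TensorProduct.rid ℂ H) (Coalgebra.sum_tmul_counit_eq r)
  simp only [map_sum, TensorProduct.rid_tmul, one_smul] at h
  conv_rhs => rw [← h]
  simp

theorem conv_charInv {g : H →ₗ[ℂ] LS} (hg : IsCharacter g) : conv g (charInv g) = epsA := by
  ext1 x
  have r := Coalgebra.Repr.arbitrary ℂ x
  rw [conv_repr _ _ r, epsA_apply, ← hg.1, ← map_smul,
    ← HopfAlgebra.sum_mul_antipode_eq_smul r, map_sum]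
  simp [charInv, hg.2]

theorem charInv_conv {g : H →ₗ[ℂ] LS} (hg : IsCharacter g) : conv (charInv g) g = epsA := by
  ext1 x
  have r := Coalgebra.Repr.arbitrary ℂ x
  rw [conv_repr _ _ r, epsA_apply, ← hg.1, ← map_smul,
    ← HopfAlgebra.sum_antipode_mul_eq_smul r, map_sum]
  simp [charInv, hg.2]

/-- Curves whose pole orders are bounded uniformly in the parameter. -/
def BddCurve (F : ℝ → (H →ₗ[ℂ] LS)) : Prop :=
  ∀ x, ∃ p : ℤ, ∀ s, ∀ n < p, (F s x).coeff n = 0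

theorem bddCurve_const (F : H →ₗ[ℂ] LS) : BddCurve (fun _ : ℝ => F) := fun x =>
  (ls_bdd (F x)).imp fun _ h _ => h

theorem coeff_fsum {ι : Type} (s : Finset ι) (f : ι → LS) (n : ℤ) :
    (∑ i ∈ s, f i).coeff n = ∑ i ∈ s, (f i).coeff n := by
  classical
  induction s using Finset.induction_on with
  | empty => simp
  | insert a s ha ih => rw [Finset.sum_insert ha, Finset.sum_insert ha, HahnSeries.coeff_add, ih]

theorem BddCurve.conv {F G : ℝ → (H →ₗ[ℂ] LS)} (hF : BddCurve F) (hG : BddCurve G) :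
    BddCurve (fun s => conv (F s) (G s)) := by
  intro x
  choose p hp using hF
  choose q hq using hG
  have r := Coalgebra.Repr.arbitrary ℂ x
  obtain ⟨m, hm⟩ := ((r.index.image fun i => p (r.left i) + q (r.right i)).finite_toSet).bddBelow
  refine ⟨m, fun s n hn => ?_⟩
  rw [conv_repr _ _ r, coeff_fsum]
  refine Finset.sum_eq_zero fun i hi => ?_
  rw [ls_coeff_mul _ _ _ _ (hp (r.left i) s) (hq (r.right i) s), Finset.Icc_eq_empty, Finset.sum_empty]
  have := hm (Finset.mem_coe.2 (Finset.mem_image_of_mem _ hi))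
  omega

theorem HasDerivAtF.conv {F G : ℝ → (H →ₗ[ℂ] LS)} {F' G' : H →ₗ[ℂ] LS} {t : ℝ}
    (hF : BddCurve F) (hG : BddCurve G) (hdF : HasDerivAtF F F' t) (hdG : HasDerivAtF G G' t) :
    HasDerivAtF (fun s => conv (F s) (G s)) (conv F' (G t) + conv (F t) G') t := by
  intro x n
  have r := Coalgebra.Repr.arbitrary ℂ x
  rw [LinearMap.add_apply]
  simp only [fun s => conv_repr (F s) (G s) r, conv_repr _ _ r, coeff_fsum, HahnSeries.coeff_add]
  rw [← Finset.sum_add_distrib]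
  refine HasDerivAt.fun_sum fun i _ => ?_
  obtain ⟨p, hp⟩ := hF (r.left i)
  obtain ⟨q, hq⟩ := hG (r.right i)
  rw [← HahnSeries.coeff_add]
  exact ls_hasDeriv_mul (fun s => F s (r.left i)) (fun s => G s (r.right i)) _ _ t p q hp hq
    (hdF _) (hdG _) n

theorem HasDerivAtF.unique' {F : ℝ → (H →ₗ[ℂ] LS)} {F' F'' : H →ₗ[ℂ] LS} {t : ℝ}
    (h : HasDerivAtF F F' t) (h' : HasDerivAtF F F'' t) : F' = F'' := by
  ext x n
  exact (h x n).unique (h' x n)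

theorem hasDerivAtF_const (F : H →ₗ[ℂ] LS) (t : ℝ) : HasDerivAtF (fun _ => F) 0 t := by
  intro x n
  simpa using hasDerivAt_const t ((F x).coeff n)

theorem eq_of_hasDerivAtF_zero {F : ℝ → (H →ₗ[ℂ] LS)} (h : ∀ t, HasDerivAtF F 0 t) (t : ℝ) :
    F t = F 0 := by
  ext x n
  refine is_const_of_deriv_eq_zero (f := fun s => (F s x).coeff n)
    (fun s => (h s x n).differentiableAt) (fun s => ?_) t 0
  simpa using (h s x n).deriv

/-- Partial sums of the exponential of `-tX`. -/
def partExp (X : H →ₗ[ℂ] LS) (c : ℂ) (M : ℕ) : H →ₗ[ℂ] LS :=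
  ∑ k ∈ Finset.range M, (((k.factorial : ℂ))⁻¹ * c ^ k) • convPow X k

theorem convPow_smul (c : ℂ) (X : H →ₗ[ℂ] LS) (k : ℕ) :
    convPow (c • X) k = c ^ k • convPow X k := by
  induction k with
  | zero => simp [convPow]
  | succ k ih => rw [convPow, convPow, ih, conv_smul', smul_conv', smul_smul, pow_succ]

theorem convPow_comm {X L : H →ₗ[ℂ] LS} (h : conv X L = conv L X) (k : ℕ) :
    conv (convPow X k) L = conv L (convPow X k) := by
  induction k with
  | zero => simp [convPow, eps_conv, conv_eps]
  | succ k ih => rw [convPow, conv_assoc', ih, ← conv_assoc', h, conv_assoc']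

theorem conv_zero' (f : H →ₗ[ℂ] LS) : conv f 0 = 0 := by
  simpa using conv_smul' 0 f 0

theorem zero_conv' (f : H →ₗ[ℂ] LS) : conv 0 f = 0 := by
  simpa using smul_conv' 0 0 f

theorem conv_sum' {ι : Type} (s : Finset ι) (f : H →ₗ[ℂ] LS) (g : ι → (H →ₗ[ℂ] LS)) :
    conv f (∑ i ∈ s, g i) = ∑ i ∈ s, conv f (g i) := by
  classical
  induction s using Finset.induction_on with
  | empty => simp [conv_zero']
  | insert a s ha ih => rw [Finset.sum_insert ha, Finset.sum_insert ha, conv_add', ih]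

theorem sum_conv' {ι : Type} (s : Finset ι) (f : H →ₗ[ℂ] LS) (g : ι → (H →ₗ[ℂ] LS)) :
    conv (∑ i ∈ s, g i) f = ∑ i ∈ s, conv (g i) f := by
  classical
  induction s using Finset.induction_on with
  | empty => simp [zero_conv']
  | insert a s ha ih => rw [Finset.sum_insert ha, Finset.sum_insert ha, add_conv', ih]

theorem partExp_comm {X L : H →ₗ[ℂ] LS} (h : conv X L = conv L X) (c : ℂ) (M : ℕ) :
    conv (partExp X c M) L = conv L (partExp X c M) := by
  simp only [partExp, conv_sum', sum_conv', conv_smul', smul_conv', convPow_comm h]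

/-- Eventual agreement of `E` with the partial sums, pointwise. -/
def EvExp (X : H →ₗ[ℂ] LS) (c : ℂ) (E : H →ₗ[ℂ] LS) : Prop :=
  ∀ x, ∃ N : ℕ, ∀ M, N ≤ M → E x = partExp X c M x

theorem evExp_of {X E : H →ₗ[ℂ] LS} {c : ℂ} (h : IsConvExp (c • X) E) : EvExp X c E := by
  intro x
  obtain ⟨N, hN⟩ := h x
  refine ⟨N, fun M hM => ?_⟩
  rw [hN M hM]
  simp [partExp, convPow_smul, smul_smul]

theorem EvExp.finset {X E : H →ₗ[ℂ] LS} {c : ℂ} (h : EvExp X c E) {ι : Type} (s : Finset ι)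
    (v : ι → H) : ∃ N : ℕ, ∀ M, N ≤ M → ∀ i ∈ s, E (v i) = partExp X c M (v i) := by
  choose N hN using h
  refine ⟨s.sup fun i => N (v i), fun M hM i hi => hN _ _ ?_⟩
  exact (Finset.le_sup (f := fun i => N (v i)) hi).trans hM

theorem EvExp.conv_right {X E : H →ₗ[ℂ] LS} {c : ℂ} (h : EvExp X c E) (Z : H →ₗ[ℂ] LS) (x : H) :
    ∃ N : ℕ, ∀ M, N ≤ M → conv Z E x = conv Z (partExp X c M) x := by
  have r := Coalgebra.Repr.arbitrary ℂ x
  obtain ⟨N, hN⟩ := h.finset r.index r.right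
  refine ⟨N, fun M hM => ?_⟩
  rw [conv_repr _ _ r, conv_repr _ _ r]
  exact Finset.sum_congr rfl fun i hi => by rw [hN M hM i hi]

theorem EvExp.conv_left {X E : H →ₗ[ℂ] LS} {c : ℂ} (h : EvExp X c E) (Z : H →ₗ[ℂ] LS) (x : H) :
    ∃ N : ℕ, ∀ M, N ≤ M → conv E Z x = conv (partExp X c M) Z x := by
  have r := Coalgebra.Repr.arbitrary ℂ x
  obtain ⟨N, hN⟩ := h.finset r.index r.left
  refine ⟨N, fun M hM => ?_⟩
  rw [conv_repr _ _ r, conv_repr _ _ r]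
  exact Finset.sum_congr rfl fun i hi => by rw [hN M hM i hi]

theorem EvExp.comm {X E L : H →ₗ[ℂ] LS} {c : ℂ} (h : EvExp X c E) (hL : conv X L = conv L X) :
    conv E L = conv L E := by
  ext1 x
  obtain ⟨N, hN⟩ := h.conv_left L x
  obtain ⟨N', hN'⟩ := h.conv_right L x
  rw [hN (max N N') (le_max_left _ _), hN' (max N N') (le_max_right _ _), partExp_comm hL]

theorem EvExp.nilp {X E : H →ₗ[ℂ] LS} {c : ℂ} (hc : c ≠ 0) (h : EvExp X c E) (x : H) :
    ∃ N : ℕ, ∀ k, N ≤ k → convPow X k x = 0 := by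
  obtain ⟨N, hN⟩ := h x
  refine ⟨N, fun k hk => ?_⟩
  have h1 := hN k hk
  have h2 := hN (k + 1) (by omega)
  rw [h1] at h2
  simp only [partExp, Finset.sum_range_succ, LinearMap.add_apply, left_eq_add,
    LinearMap.smul_apply] at h2
  refine (smul_eq_zero.1 h2).resolve_left ?_
  exact mul_ne_zero (inv_ne_zero (by exact_mod_cast k.factorial_ne_zero)) (pow_ne_zero _ hc)

theorem partExp_stable {X : H →ₗ[ℂ] LS} {x : H} {N : ℕ} (hN : ∀ k, N ≤ k → convPow X k x = 0)
    (c : ℂ) {M : ℕ} (hM : N ≤ M) : partExp X c M x = partExp X c N x := by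
  induction M, hM using Nat.le_induction with
  | base => rfl
  | succ M hM ih =>
    rw [← ih]
    simp [partExp, Finset.sum_range_succ, hN M hM]

theorem EvExp.eq {X E : H →ₗ[ℂ] LS} {c : ℂ} (h : EvExp X c E) {x : H} {N : ℕ}
    (hN : ∀ k, N ≤ k → convPow X k x = 0) : E x = partExp X c N x := by
  obtain ⟨N', hN'⟩ := h x
  rw [hN' (max N N') (le_max_right _ _), partExp_stable hN c (le_max_left _ _)]

theorem coeff_csmul (c : ℂ) (a : LS) (n : ℤ) : (c • a).coeff n = c * a.coeff n := rfl

/-- The exponential curve `t ↦ exp(-tX)` has bounded poles. -/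
theorem bddCurve_exp {X : H →ₗ[ℂ] LS} {E : ℝ → (H →ₗ[ℂ] LS)}
    (h : ∀ t : ℝ, EvExp X (-(t : ℂ)) (E t)) : BddCurve E := by
  intro x
  obtain ⟨N, hN⟩ := (h 1).nilp (by simp) x
  choose p hp using fun k => ls_bdd (convPow X k x)
  obtain ⟨m, hm⟩ := (((Finset.range N).image p).finite_toSet).bddBelow
  refine ⟨m, fun s n hn => ?_⟩
  rw [(h s).eq hN, partExp, LinearMap.sum_apply, coeff_fsum]
  refine Finset.sum_eq_zero fun k hk => ?_
  have := hm (Finset.mem_coe.2 (Finset.mem_image_of_mem p hk))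
  rw [LinearMap.smul_apply, coeff_csmul, hp k n (by omega), mul_zero]

theorem hasDerivAtF_exp {X : H →ₗ[ℂ] LS} {E : ℝ → (H →ₗ[ℂ] LS)}
    (h : ∀ t : ℝ, EvExp X (-(t : ℂ)) (E t)) (t : ℝ) :
    HasDerivAtF E (-(conv X (E t))) t := by
  intro x n
  obtain ⟨N, hN⟩ := (h 1).nilp (by simp) x
  obtain ⟨N', hN'⟩ := (h t).conv_right X x
  have hN1 : ∀ k, max N N' + 1 ≤ k → convPow X k x = 0 := fun k hk => hN k (by omega)
  have hE : (fun s : ℝ => (E s x).coeff n) = fun s : ℝ => ∑ k ∈ Finset.range (max N N' + 1),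
      (((k.factorial : ℂ))⁻¹ * (-(s : ℂ)) ^ k) * (convPow X k x).coeff n := by
    funext s
    rw [(h s).eq hN1, partExp, LinearMap.sum_apply, coeff_fsum]
    rfl
  have hR : ((-(conv X (E t))) x).coeff n = ∑ k ∈ Finset.range (max N N'),
      -((((k.factorial : ℂ))⁻¹ * (-(t : ℂ)) ^ k) * (convPow X (k + 1) x).coeff n) := by
    rw [LinearMap.neg_apply, hN' _ (le_max_right N N'), partExp, conv_sum', LinearMap.sum_apply,
      HahnSeries.coeff_neg, coeff_fsum, Finset.sum_neg_distrib]
    simp only [conv_smul']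
    rfl
  rw [hE, hR]
  have : ∀ k ∈ Finset.range (max N N' + 1), HasDerivAt (fun s : ℝ =>
      (((k.factorial : ℂ))⁻¹ * (-(s : ℂ)) ^ k) * (convPow X k x).coeff n)
      ((((k.factorial : ℂ))⁻¹ * (k * (-(t : ℂ)) ^ (k - 1) * (-1))) * (convPow X k x).coeff n) t := by
    intro k _
    have h1 : HasDerivAt (fun s : ℝ => -(s : ℂ)) (-1) t := (Complex.ofRealCLM.hasDerivAt).neg
    exact ((h1.pow k).const_mul _).mul_const _
  have h2 := HasDerivAt.fun_sum this
  rw [Finset.sum_range_succ'] at h2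
  refine h2.congr_deriv (Eq.symm ?_)
  rw [Nat.cast_zero, zero_mul, zero_mul, mul_zero, zero_mul, add_zero]
  refine Finset.sum_congr rfl fun k _ => ?_
  have : ((k + 1 : ℕ) : ℂ) ≠ 0 := by exact_mod_cast k.succ_ne_zero
  rw [Nat.factorial_succ, Nat.add_sub_cancel]
  have h3 : ((k.factorial : ℕ) : ℂ) ≠ 0 := by exact_mod_cast k.factorial_ne_zero
  push_cast at this ⊢
  field_simp

end ConvAlg
section LaxMain

variable {H : Type} [Ring H] [HopfAlgebra ℂ H]

/-- The derivative of a holomorphic-valued differentiable curve. -/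
def derivPlus (F : ℝ → (H →ₗ[ℂ] LS)) (hp : ∀ t x, Aplus (F t x))
    (hd : PointwiseDifferentiable F) (t : ℝ) : H →ₗ[ℂ] LS where
  toFun x := HahnSeries.ofSuppBddBelow (fun n => deriv (fun s => (F s x).coeff n) t) (by
    refine ⟨0, fun n hn => ?_⟩
    by_contra h
    apply hn
    have : (fun s => (F s x).coeff n) = fun _ => 0 := funext fun s => hp s x n (by omega)
    simp [this])
  map_add' x y := by
    ext n
    simp only [map_add, HahnSeries.coeff_add, HahnSeries.coeff_ofSuppBddBelow]
    exact deriv_fun_add (hd x n t) (hd y n t)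
  map_smul' c x := by
    ext n
    simp only [map_smul, RingHom.id_apply, coeff_csmul]
    exact deriv_const_mul c (hd x n t)

theorem hasDerivAtF_derivPlus (F : ℝ → (H →ₗ[ℂ] LS)) (hp : ∀ t x, Aplus (F t x))
    (hd : PointwiseDifferentiable F) (t : ℝ) : HasDerivAtF F (derivPlus F hp hd t) t :=
  fun x n => (hd x n t).hasDerivAt

theorem HasDerivAtF.charInv {F : ℝ → (H →ₗ[ℂ] LS)} {F' : H →ₗ[ℂ] LS} {t : ℝ}
    (h : HasDerivAtF F F' t) : HasDerivAtF (fun s => charInv (F s)) (charInv F') t :=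
  fun x n => h _ n

theorem Rop_coeff (a : LS) (n : ℤ) :
    (Rop a).coeff n = if n < 0 then -a.coeff n else a.coeff n := rfl

theorem Rop_of_split {a y : LS} (ha : Aplus a) (hy : Aminus (a + y)) :
    (1 / 2 : ℂ) • Rop y = -a - (1 / 2 : ℂ) • y := by
  ext n
  rw [coeff_csmul, Rop_coeff, HahnSeries.coeff_sub, HahnSeries.coeff_neg, coeff_csmul]
  split_ifs with h
  · rw [ha n h]; ring
  · have := hy n (by omega)
    rw [HahnSeries.coeff_add] at this
    linear_combination this

theorem ls_coeff_mul_top (a b : LS) (p q n : ℤ) (ha : ∀ k, p ≤ k → a.coeff k = 0)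
    (hb : ∀ k, q < k → b.coeff k = 0) (hn : p + q ≤ n) : (a * b).coeff n = 0 := by
  obtain ⟨u, hu⟩ := ls_bdd a
  obtain ⟨v, hv⟩ := ls_bdd b
  rw [ls_coeff_mul a b u v hu hv]
  refine Finset.sum_eq_zero fun i _ => ?_
  by_cases h : p ≤ i
  · rw [ha i h, zero_mul]
  · rw [hb (n - i) (by omega), mul_zero]

theorem epsA_coeff_ne (x : H) (n : ℤ) (hn : n ≠ 0) : (epsA x).coeff n = 0 := by
  rw [epsA_apply, coeff_csmul, HahnSeries.coeff_one, if_neg hn, mul_zero]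

theorem conv_minus {D g : H →ₗ[ℂ] LS} (hD : ∀ x, Aminus (D x))
    (hg : ∀ x, Aminus (g x - epsA x)) (x : H) : Aminus (conv D (charInv g) x) := by
  intro n hn
  have r := Coalgebra.Repr.arbitrary ℂ x
  rw [conv_repr _ _ r, coeff_fsum]
  refine Finset.sum_eq_zero fun i _ => ?_
  refine ls_coeff_mul_top _ _ 0 0 n (fun k hk => hD _ k hk) (fun k hk => ?_) (by simpa using hn)
  have := hg (HopfAlgebra.antipode (R := ℂ) (r.right i)) k hk.le
  rw [HahnSeries.coeff_sub, epsA_coeff_ne _ _ hk.ne', sub_zero] at this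
  exact this

theorem conv_plus {D g : H →ₗ[ℂ] LS} (hD : ∀ x, Aplus (D x))
    (hg : ∀ x, Aplus (g x)) (x : H) : Aplus (conv D (charInv g) x) := by
  intro n hn
  have r := Coalgebra.Repr.arbitrary ℂ x
  rw [conv_repr _ _ r, coeff_fsum]
  refine Finset.sum_eq_zero fun i _ => ?_
  rw [ls_coeff_mul (D (r.left i)) (charInv g (r.right i)) 0 0 (hD _) (hg _), Finset.Icc_eq_empty (by omega), Finset.sum_empty]

theorem lax_core
    (X : H →ₗ[ℂ] LS) (L0 : H →ₗ[ℂ] LS) (hcomm : conv X L0 = conv L0 X)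
    (gm gp : ℝ → (H →ₗ[ℂ] LS))
    (hgmchar : ∀ t, IsCharacter (gm t)) (hgpchar : ∀ t, IsCharacter (gp t))
    (hgm0 : gm 0 = epsA) (hgp0 : gp 0 = epsA)
    (hgpplus : ∀ t x, Aplus (gp t x))
    (hgmminus : ∀ t x, Aminus (gm t x - epsA x))
    (hdp : PointwiseDifferentiable gp)
    (hfact : ∀ t : ℝ, IsConvExp ((-(t : ℂ)) • X) (conv (charInv (gm t)) (gp t))) :
    (∀ t : ℝ, Adc (gm t) L0 = Adc (gp t) L0) ∧
    ∀ t : ℝ, HasDerivAtF (fun s : ℝ => Adc (gp s) L0)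
      (lieBr (Adc (gp t) L0) ((1 / 2 : ℂ) • (Rop ∘ₗ Adc (gp t) X))) t := by
  set E : ℝ → (H →ₗ[ℂ] LS) := fun t => conv (charInv (gm t)) (gp t) with hEdef
  have hE : ∀ t : ℝ, EvExp X (-(t : ℂ)) (E t) := fun t => evExp_of (hfact t)
  have hgmE : ∀ t, conv (gm t) (E t) = gp t := fun t => by
    rw [hEdef]; simp only
    rw [← conv_assoc', conv_charInv (hgmchar t), eps_conv]
  have hE0 : E 0 = epsA := by
    have := hgmE 0
    rwa [hgm0, eps_conv, hgp0] at this
  have hEL : ∀ t, conv (E t) L0 = conv L0 (E t) := fun t => (hE t).comm hcomm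
  have hEX : ∀ t, conv (E t) X = conv X (E t) := fun t => (hE t).comm rfl
  have hEgp : ∀ t, conv (E t) (charInv (gp t)) = charInv (gm t) := fun t => by
    rw [hEdef]; simp only
    rw [conv_assoc', conv_charInv (hgpchar t), conv_eps]
  refine ⟨fun t => ?_, fun t => ?_⟩
  · rw [Adc, Adc, ← hEgp, ← conv_assoc' L0, ← hEL, ← conv_assoc', ← conv_assoc', hgmE, conv_assoc']
  have hbE : BddCurve E := bddCurve_exp hE
  have hdE : ∀ t, HasDerivAtF E (-(conv X (E t))) t := hasDerivAtF_exp hE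
  have hbEn : BddCurve (fun s => E (-s)) := fun x => (hbE x).imp fun p hp s => hp (-s)
  have hdEn : ∀ t, HasDerivAtF (fun s => E (-s)) (conv X (E (-t))) t := fun t x n => by
    have h1 := (hdE (-t) x n).scomp t (hasDerivAt_neg t)
    refine HasDerivAt.congr_deriv (f := fun s => (E (-s) x).coeff n) h1 ?_
    simp
  have hEE : ∀ t, conv (E t) (E (-t)) = epsA := fun t => by
    have h : ∀ t, HasDerivAtF (fun s => conv (E s) (E (-s))) 0 t := fun t => by
      have := HasDerivAtF.conv hbE hbEn (hdE t) (hdEn t)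
      rw [neg_conv', ← conv_assoc' (E t), hEX, neg_add_lm] at this
      exact this
    rw [eq_of_hasDerivAtF_zero h t, neg_zero, hE0, eps_conv]
  have hgm : ∀ t, conv (gp t) (E (-t)) = gm t := fun t => by
    rw [← hgmE, conv_assoc', hEE, conv_eps]
  have hEngm : conv (E (-t)) (charInv (gm t)) = charInv (gp t) := by
    have h1 : conv (gp t) (conv (E (-t)) (charInv (gm t))) = epsA := by
      rw [← conv_assoc', hgm, conv_charInv (hgmchar t)]
    have h2 := congrArg (conv (charInv (gp t))) h1
    rwa [← conv_assoc', charInv_conv (hgpchar t), eps_conv, conv_eps] at h2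
  have hbp : BddCurve gp := fun x => ⟨0, fun s n hn => hgpplus s x n hn⟩
  have hbpi : BddCurve (fun s => charInv (gp s)) := fun x => ⟨0, fun s n hn => hgpplus s _ n hn⟩
  set D := derivPlus gp hgpplus hdp t with hD
  have hDp : HasDerivAtF gp D t := hasDerivAtF_derivPlus gp hgpplus hdp t
  have hDi : HasDerivAtF (fun s => charInv (gp s)) (charInv D) t := hDp.charInv
  have hDplus : ∀ x, Aplus (D x) := fun x n hn => by
    have h := hDp x n
    simp only [hgpplus _ x n hn] at h
    exact h.unique (hasDerivAt_const _ _)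
  have hDm : HasDerivAtF gm (conv D (E (-t)) + conv (gp t) (conv X (E (-t)))) t := by
    have := HasDerivAtF.conv hbp hbEn hDp (hdEn t)
    simpa only [hgm] using this
  have hDmminus : ∀ x, Aminus ((conv D (E (-t)) + conv (gp t) (conv X (E (-t)))) x) := by
    intro x n hn
    have h := hDm x n
    have h' : (fun s => (gm s x).coeff n) = fun _ => (epsA x).coeff n := funext fun s => by
      have := hgmminus s x n hn
      rwa [HahnSeries.coeff_sub, sub_eq_zero] at this
    rw [h'] at h
    exact h.unique (hasDerivAt_const _ _)
  set a := conv D (charInv (gp t)) with ha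
  have haplus : ∀ x, Aplus (a x) := conv_plus hDplus (hgpplus t)
  have haminus : ∀ x, Aminus (a x + Adc (gp t) X x) := by
    intro x
    have := conv_minus hDmminus (hgmminus t) x
    rw [add_conv', conv_assoc', hEngm, conv_assoc', conv_assoc', hEngm] at this
    exact this
  have hM : (1 / 2 : ℂ) • (Rop ∘ₗ Adc (gp t) X) = -a + (-(1 / 2) : ℂ) • Adc (gp t) X := by
    ext1 x
    have := Rop_of_split (haplus x) (haminus x)
    rw [LinearMap.smul_apply, LinearMap.comp_apply, this, LinearMap.add_apply, LinearMap.neg_apply,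
      LinearMap.smul_apply, neg_smul, sub_eq_add_neg]
  have hinv : conv (gp t) (charInv D) = -a := by
    have h1 := HasDerivAtF.conv hbp hbpi hDp hDi
    simp only [fun s => conv_charInv (hgpchar s)] at h1
    exact eq_neg_lm (h1.unique' (hasDerivAtF_const _ t))
  have hinv' : charInv D = -(conv (charInv (gp t)) a) := by
    have h2 := congrArg (conv (charInv (gp t))) hinv
    rwa [← conv_assoc', charInv_conv (hgpchar t), eps_conv, conv_neg'] at h2
  have hLY : conv (Adc (gp t) L0) (Adc (gp t) X) = conv (Adc (gp t) X) (Adc (gp t) L0) := by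
    have key : ∀ U V : H →ₗ[ℂ] LS, conv (Adc (gp t) U) (Adc (gp t) V) = Adc (gp t) (conv U V) := by
      intro U V
      simp only [Adc, conv_assoc']
      rw [← conv_assoc' (charInv (gp t)) (gp t), charInv_conv (hgpchar t), eps_conv]
    rw [key, key, hcomm]
  have hmain := HasDerivAtF.conv hbp ((bddCurve_const L0).conv hbpi) hDp
    (HasDerivAtF.conv (bddCurve_const L0) hbpi (hasDerivAtF_const L0 t) hDi)
  have hval : conv D (conv L0 (charInv (gp t))) +
      conv (gp t) (conv 0 (charInv (gp t)) + conv L0 (charInv D)) =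
      lieBr (Adc (gp t) L0) ((1 / 2 : ℂ) • (Rop ∘ₗ Adc (gp t) X)) := by
    have e1 : conv D (conv L0 (charInv (gp t))) = conv a (Adc (gp t) L0) := by
      rw [ha, Adc, conv_assoc', ← conv_assoc' (charInv (gp t)), charInv_conv (hgpchar t), eps_conv]
    have e2 : conv (gp t) (conv L0 (charInv D)) = - conv (Adc (gp t) L0) a := by
      rw [hinv', conv_neg', conv_neg', Adc, conv_assoc', conv_assoc']
    rw [zero_conv', zero_add, e1, e2, lieBr, hM, conv_add', add_conv', conv_neg', neg_conv',
      conv_smul', smul_conv', hLY]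
    abel
  rw [← hval]
  exact hmain

end LaxMain

/-- **Theorem (Lax pair from Birkhoff factorization).**
Let `H` be a connected graded commutative Hopf algebra, `g_A` its Lie algebra
of infinitesimal characters with values in Laurent series, `f : g_A → g_A` an
`Ad`-covariant map, `L₀ ∈ g_A` with `[f(L₀), L₀] = 0` and `X = f(L₀)`.  If
`g_± : ℝ → G_A` are pointwise differentiable curves with `g_±(0) = ε` giving
the Birkhoff factorization `exp(−tX) = g₋(t)⁻¹ ⋆ g₊(t)` (with `g₊(t)`
holomorphic-valued and `g₋(t) − ε` pure pole part), then
`Ad(g₋(t))L₀ = Ad(g₊(t))L₀` for all `t`, and `L(t) := Ad(g₊(t))L₀` satisfies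
the Lax pair equation `dL/dt = [L, M]` with `M = ½·R(f(L))`. -/
theorem lax_pair_flow_hopf
    {H : Type} [CommRing H] [HopfAlgebra ℂ H]
    (𝒜 : ℕ → Submodule ℂ H) [GradedAlgebra 𝒜]
    (hconn : IsConnectedGrading 𝒜) (hΔ : ComulGraded 𝒜)
    (hcounit : CounitGraded 𝒜) (hS : AntipodeGraded 𝒜)
    (f : (H →ₗ[ℂ] LS) → (H →ₗ[ℂ] LS))
    (hfinf : ∀ Z : H →ₗ[ℂ] LS, IsInfChar Z → IsInfChar (f Z))
    (hfad : ∀ g Z : H →ₗ[ℂ] LS, IsCharacter g → IsInfChar Z →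
      f (Adc g Z) = Adc g (f Z))
    (L0 : H →ₗ[ℂ] LS) (hL0 : IsInfChar L0)
    (hcomm : lieBr (f L0) L0 = 0)
    (gm gp : ℝ → (H →ₗ[ℂ] LS))
    (hgmchar : ∀ t, IsCharacter (gm t)) (hgpchar : ∀ t, IsCharacter (gp t))
    (hgm0 : gm 0 = epsA) (hgp0 : gp 0 = epsA)
    (hgpplus : ∀ t x, Aplus (gp t x))
    (hgmminus : ∀ t x, Aminus (gm t x - epsA x))
    (hdm : PointwiseDifferentiable gm) (hdp : PointwiseDifferentiable gp)
    (hfact : ∀ t : ℝ,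
      IsConvExp ((-(t : ℂ)) • f L0) (conv (charInv (gm t)) (gp t))) :
    (∀ t : ℝ, Adc (gm t) L0 = Adc (gp t) L0) ∧
    ∀ t : ℝ, HasDerivAtF (fun s : ℝ => Adc (gp s) L0)
      (lieBr (Adc (gp t) L0) ((1 / 2 : ℂ) • (Rop ∘ₗ f (Adc (gp t) L0)))) t := by
  have hc : conv (f L0) L0 = conv L0 (f L0) := sub_eq_zero.1 hcomm
  have h := lax_core (f L0) L0 hc gm gp hgmchar hgpchar hgm0 hgp0 hgpplus hgmminus hdp hfact
  refine ⟨h.1, fun t => ?_⟩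
  rw [hfad (gp t) L0 (hgpchar t) hL0]
  exact h.2 t

end
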